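/- Let Ω = [−1,1]×[0,1] ⊆ ℝ², 0 < p < ∞, 0 < s < 2/p and 1/τ = s/2 + 1/p, and assume τ ≤ 1. For ε ∈ (0,1/4) define the piecewise linear functions S₁(x) = x₁·1_{[0,1]²}(x) (continuous) and S₂(x) = x₁·1_{[ε,1]×[0,1]}(x) (discontinuous along x₁ = ε). Then there exist constants c > 0 and ε₀ > 0, depending only on s, p, such that for all 0 < ε < ε₀: |S₂|_{B^{s,2}_τ}^τ − |S₁|_{B^{s,2}_τ}^τ ≥ c·ε^{τ − sτ + 1}, and consequently, since ‖S₂ − S₁‖_{L^p(Ω)} ≤ ε^{1 + 1/p}, the ratio (|S₂|_{B^{s,2}_τ}^τ − |S₁|_{B^{s,2}_τ}^τ) / ‖S₂ − S₁‖_{L^p(Ω)}^τ ≥ c·ε^{−sτ/2}, which tends to ∞ as ε → 0; hence the Bernstein-type estimate |S₂|^τ ≤ |S₁|^τ + c'·n^{τs/2}‖S₂ − S₁‖_{L^p}^τ fails for discontinuous piecewise linear functions. -/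

import Mathlib

open scoped Classical

open Set Metric MeasureTheory ENNReal

noncomputable section

/-- The Euclidean plane `ℝ²`. -/
abbrev Plane : Type := EuclideanSpace ℝ (Fin 2)

/-- `Q` is a compact regular convex set whose boundary is a polygon consisting of at most
`N₀` line segments, with eccentricity bounded by `c₀`. -/
def IsRegularConvexPolygon (N₀ : ℕ) (c₀ : ℝ) (Q : Set Plane) : Prop :=
  IsCompact Q ∧ Convex ℝ Q ∧ Q.Nonempty ∧
    (∃ (m : ℕ) (v w : Fin m → Plane), m ≤ N₀ ∧ frontier Q = ⋃ i, segment ℝ (v i) (w i)) ∧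
    (∃ (x₁ x₂ : Plane) (r₁ r₂ : ℝ), 0 < r₂ ∧
      closedBall x₂ r₂ ⊆ Q ∧ Q ⊆ closedBall x₁ r₁ ∧ r₁ ≤ c₀ * r₂)

/-- There is a triangle contained in `R` having the segment `[a,b]` as a side, whose two
angles adjacent to that side are equal to `β`. -/
def HasGoodTriangle (β : ℝ) (R : Set Plane) (a b : Plane) : Prop :=
  ∃ c : Plane, convexHull ℝ {a, b, c} ⊆ R ∧
    EuclideanGeometry.angle b a c = β ∧ EuclideanGeometry.angle a b c = β

/-- `R ⊆ ℝ²` is a ring with structural parameters `N₀`, `c₀`, `β`: the difference of two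
regular compact convex sets with polygonal boundaries, admitting no uncontrollably narrow
elongated subregions (each maximal edge of the boundary can be subdivided into at most two
segments, each carrying a good triangle with adjacent angles `β` inside `R`). -/
def IsRing (N₀ : ℕ) (c₀ β : ℝ) (R : Set Plane) : Prop :=
  (∃ Q₁ Q₂ : Set Plane,
      IsRegularConvexPolygon N₀ c₀ Q₁ ∧
      (Q₂ = ∅ ∨ (Q₂ ⊆ Q₁ ∧ IsRegularConvexPolygon N₀ c₀ Q₂)) ∧
      R = Q₁ \ interior Q₂) ∧
  (∃ (m : ℕ) (v w : Fin m → Plane),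
      frontier R = ⋃ i, segment ℝ (v i) (w i) ∧
      (∀ i, ∀ a b : Plane, segment ℝ (v i) (w i) ⊆ segment ℝ a b →
        segment ℝ a b ⊆ frontier R → segment ℝ a b = segment ℝ (v i) (w i)) ∧
      (∀ i, ∃ p ∈ segment ℝ (v i) (w i),
        HasGoodTriangle β R (v i) p ∧ HasGoodTriangle β R p (w i)))

/-- `Ω` is the union of `n` rings with pairwise disjoint interiors. -/
def IsRingDecomp (N₀ : ℕ) (c₀ β : ℝ) (n : ℕ) (Ω : Set Plane) : Prop :=
  ∃ R : Fin n → Set Plane,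
    (∀ j, IsRing N₀ c₀ β (R j)) ∧
    (∀ i j, i ≠ j → interior (R i) ∩ interior (R j) = ∅) ∧
    (⋃ j, R j) = Ω

/-- Membership in the nonlinear spline class `S(n,k)`: piecewise polynomials of total degree
`< k` over `n` rings with pairwise disjoint interiors whose union is `Ω` (or, when `Ω = ℝ²`,
whose union -- the support of the spline -- is itself a ring), having maximum smoothness
`W^{k-2}(Ω)` when `k ≥ 2` (no smoothness is required for piecewise constants, `k = 1`). -/
def IsSpline (N₀ : ℕ) (c₀ β : ℝ) (n k : ℕ) (Ω : Set Plane) (S : Plane → ℝ) : Prop :=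
  ∃ (R : Fin n → Set Plane) (P : Fin n → MvPolynomial (Fin 2) ℝ),
    (∀ j, IsRing N₀ c₀ β (R j)) ∧
    (∀ i j, i ≠ j → interior (R i) ∩ interior (R j) = ∅) ∧
    ((⋃ j, R j) = Ω ∨ (Ω = Set.univ ∧ IsRing N₀ c₀ β (⋃ j, R j))) ∧
    (∀ j, (P j).totalDegree < k) ∧
    (S = fun x => ∑ j, (R j).indicator (fun y => MvPolynomial.eval (fun i => y i) (P j)) x) ∧
    (2 ≤ k → ContDiffOn ℝ ((k - 2 : ℕ) : ℕ∞) S Ω)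

/-- The spline class `S(n,k,r)` with defect: smoothness `W^r(Ω)` instead of the maximal
smoothness `W^{k-2}(Ω)`. -/
def IsSplineDefect (N₀ : ℕ) (c₀ β : ℝ) (n k r : ℕ) (Ω : Set Plane) (S : Plane → ℝ) : Prop :=
  ∃ (R : Fin n → Set Plane) (P : Fin n → MvPolynomial (Fin 2) ℝ),
    (∀ j, IsRing N₀ c₀ β (R j)) ∧
    (∀ i j, i ≠ j → interior (R i) ∩ interior (R j) = ∅) ∧
    ((⋃ j, R j) = Ω ∨ (Ω = Set.univ ∧ IsRing N₀ c₀ β (⋃ j, R j))) ∧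
    (∀ j, (P j).totalDegree < k) ∧
    (S = fun x => ∑ j, (R j).indicator (fun y => MvPolynomial.eval (fun i => y i) (P j)) x) ∧
    ContDiffOn ℝ ((r : ℕ) : ℕ∞) S Ω

/-- The `L^p(Ω)` quasi-norm, `0 < p < ∞`. -/
def lpNormE (p : ℝ) (Ω : Set Plane) (f : Plane → ℝ) : ℝ≥0∞ :=
  eLpNorm f (ENNReal.ofReal p) (volume.restrict Ω)

/-- `k`-th finite difference `Δ_h^k f(x)`, set to `0` unless the segment `[x, x+kh] ⊆ Ω`. -/
def deltah (Ω : Set Plane) (k : ℕ) (h : Plane) (f : Plane → ℝ) (x : Plane) : ℝ :=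
  if segment ℝ x (x + (k : ℝ) • h) ⊆ Ω then
    ∑ ν ∈ Finset.range (k + 1), (-1 : ℝ) ^ (k + ν) * (k.choose ν : ℝ) * f (x + (ν : ℝ) • h)
  else 0

/-- Modulus of smoothness `ω_k(f,t)_τ = sup_{|h| ≤ t} ‖Δ_h^k f‖_{L^τ(Ω)}`. -/
def modulus (Ω : Set Plane) (k : ℕ) (τ : ℝ) (f : Plane → ℝ) (t : ℝ) : ℝ≥0∞ :=
  ⨆ (h : Plane) (_ : ‖h‖ ≤ t), lpNormE τ Ω (deltah Ω k h f)

/-- Besov seminorm `|f|_{B^{s,k}_τ} = (∫₀^∞ [t^{-s} ω_k(f,t)_τ]^τ dt/t)^{1/τ}`. -/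
def besovSeminorm (Ω : Set Plane) (k : ℕ) (s τ : ℝ) (f : Plane → ℝ) : ℝ≥0∞ :=
  (∫⁻ t in Set.Ioi (0 : ℝ),
      (ENNReal.ofReal (t ^ (-s)) * modulus Ω k τ f t) ^ τ / ENNReal.ofReal t) ^ (1 / τ)

/-- Error of best `L^p(Ω)`-approximation `S_n^k(f)_p` from the spline class `S(n,k)`. -/
def splineApprox (N₀ : ℕ) (c₀ β : ℝ) (n k : ℕ) (p : ℝ) (Ω : Set Plane) (f : Plane → ℝ) :
    ℝ≥0∞ :=
  ⨅ (S : Plane → ℝ) (_ : IsSpline N₀ c₀ β n k Ω S), lpNormE p Ω fun x => f x - S x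

/-- The K-functional `K(f,t; L^p(Ω), B^{s,k}_τ)`. -/
def kFunctional (Ω : Set Plane) (k : ℕ) (s τ p : ℝ) (f : Plane → ℝ) (t : ℝ) : ℝ≥0∞ :=
  ⨅ g : Plane → ℝ,
    lpNormE p Ω (fun x => f x - g x) + ENNReal.ofReal t * besovSeminorm Ω k s τ g

/-- BV seminorm: the total mass of the distributional gradient of `g` on `Ω`, defined by
duality against compactly supported `C¹` vector fields of norm at most one. -/
def bvSeminorm (Ω : Set Plane) (g : Plane → ℝ) : ℝ≥0∞ :=
  ⨆ (φ : Plane → Plane) (_ : ContDiff ℝ 1 φ ∧ HasCompactSupport φ ∧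
      tsupport φ ⊆ interior Ω ∧ ∀ x, ‖φ x‖ ≤ 1),
    ENNReal.ofReal (∫ x in Ω, g x * ∑ i, fderiv ℝ φ x (EuclideanSpace.single i 1) i)

/-- The K-functional `K(f,t; L²(Ω), BV(Ω))`. -/
def kFunctionalBV (Ω : Set Plane) (f : Plane → ℝ) (t : ℝ) : ℝ≥0∞ :=
  ⨅ g : Plane → ℝ,
    lpNormE 2 Ω (fun x => f x - g x) + ENNReal.ofReal t * bvSeminorm Ω g

/-- The domain `Ω = [-1,1] × [0,1]`. -/
def domEx : Set Plane := {x : Plane | x 0 ∈ Set.Icc (-1 : ℝ) 1 ∧ x 1 ∈ Set.Icc (0 : ℝ) 1}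

/-- `S₁(x) = x₁ · 1_{[0,1]²}(x)`, a continuous piecewise linear function. -/
def splineCont : Plane → ℝ :=
  Set.indicator {x : Plane | x 0 ∈ Set.Icc (0 : ℝ) 1 ∧ x 1 ∈ Set.Icc (0 : ℝ) 1} fun x => x 0

/-- `S₂(x) = x₁ · 1_{[ε,1]×[0,1]}(x)`, discontinuous along `x₁ = ε`. -/
def splineDisc (ε : ℝ) : Plane → ℝ :=
  Set.indicator {x : Plane | x 0 ∈ Set.Icc ε 1 ∧ x 1 ∈ Set.Icc (0 : ℝ) 1} fun x => x 0

/-- The discontinuous ramp `u · 1_{[ε,∞)}(u)`. -/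
def ramp (ε u : ℝ) : ℝ := if ε ≤ u then u else 0

/-- The centres `v` for which `[v - |a|, v + |a|] ⊆ [-1, 1]`. -/
def centreSet (a : ℝ) : Set ℝ := {v | v - a ∈ Icc (-1 : ℝ) 1 ∧ v + a ∈ Icc (-1 : ℝ) 1}

/-- The `τ`-th power of the absolute centred second difference of the ramp. -/
def rampDiff (τ ε a v : ℝ) : ℝ≥0∞ :=
  ‖ramp ε (v + a) - 2 * ramp ε v + ramp ε (v - a)‖ₑ ^ τ

/-- The integral of `rampDiff` over the admissible centres. -/
def rampMass (τ ε a : ℝ) : ℝ≥0∞ := ∫⁻ v in centreSet a, rampDiff τ ε a v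

lemma measurable_ramp (ε : ℝ) : Measurable (ramp ε) :=
  Measurable.ite measurableSet_Ici measurable_id measurable_const

lemma measurable_rampDiff (τ ε a : ℝ) : Measurable (rampDiff τ ε a) := by
  have h := measurable_ramp ε
  have h1 : Measurable fun v => ramp ε (v + a) := h.comp (measurable_id.add_const a)
  have h2 : Measurable fun v => ramp ε (v - a) := h.comp (measurable_id.sub_const a)
  exact (((h1.sub (h.const_mul 2)).add h2).enorm).pow_const τ

lemma measurableSet_centreSet (a : ℝ) : MeasurableSet (centreSet a) :=
  (measurableSet_Icc.preimage (measurable_id.sub_const a)).inter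
    (measurableSet_Icc.preimage (measurable_id.add_const a))

lemma measurePreserving_plane_prod :
    MeasurePreserving (fun x : Plane => (x 0, x 1)) volume volume :=
  (volume_preserving_finTwoArrow ℝ).comp (PiLp.volume_preserving_ofLp (Fin 2))

lemma lintegral_plane_mul {U V : ℝ → ℝ≥0∞} (hU : Measurable U) (hV : Measurable V) :
    ∫⁻ x : Plane, U (x 0) * V (x 1) = (∫⁻ u, U u) * ∫⁻ y, V y := by
  have h := measurePreserving_plane_prod.lintegral_comp
    (f := fun z : ℝ × ℝ => U z.1 * V z.2)
    ((hU.comp measurable_fst).mul (hV.comp measurable_snd))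
  rw [h, Measure.volume_eq_prod, lintegral_prod_mul hU.aemeasurable hV.aemeasurable]

lemma convex_domEx : Convex ℝ domEx := by
  intro x hx y hy a b ha hb hab
  have h0 := convex_Icc (-1 : ℝ) 1 hx.1 hy.1 ha hb hab
  have h1 := convex_Icc (0 : ℝ) 1 hx.2 hy.2 ha hb hab
  exact ⟨by simpa using h0, by simpa using h1⟩

lemma segment_subset_domEx_iff {x y : Plane} :
    segment ℝ x y ⊆ domEx ↔ x ∈ domEx ∧ y ∈ domEx :=
  ⟨fun h => ⟨h (left_mem_segment ℝ x y), h (right_mem_segment ℝ x y)⟩,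
    fun h => convex_domEx.segment_subset h.1 h.2⟩

lemma splineDisc_eq_ramp (ε : ℝ) {x : Plane} (hx : x ∈ domEx) :
    splineDisc ε x = ramp ε (x 0) := by
  have h0 := hx.1.2
  have h1 := hx.2
  unfold splineDisc ramp
  by_cases h : ε ≤ x 0
  · rw [if_pos h, indicator_of_mem]
    exact ⟨⟨h, h0⟩, h1⟩
  · rw [if_neg h, indicator_of_notMem]
    exact fun hh => h hh.1.1

lemma measurableSet_domEx : MeasurableSet domEx :=
  (measurableSet_Icc.prod measurableSet_Icc).preimage measurePreserving_plane_prod.measurable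

lemma lpNormE_rpow {τ : ℝ} (hτ : 0 < τ) (Ω : Set Plane) (f : Plane → ℝ) :
    lpNormE τ Ω f ^ τ = ∫⁻ x in Ω, ‖f x‖ₑ ^ τ := by
  unfold lpNormE
  rw [eLpNorm_eq_lintegral_rpow_enorm_toReal (by simpa using hτ) ENNReal.ofReal_ne_top,
    ENNReal.toReal_ofReal hτ.le, ← ENNReal.rpow_mul, one_div_mul_cancel hτ.ne', ENNReal.rpow_one]

/-- The heights `y` with `y, y + 2 b ∈ [0, 1]`. -/
def heightSet (b : ℝ) : Set ℝ := {y | y ∈ Icc (0 : ℝ) 1 ∧ y + 2 * b ∈ Icc (0 : ℝ) 1}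

lemma volume_heightSet_le (b : ℝ) : volume (heightSet b) ≤ 1 := by
  calc volume (heightSet b) ≤ volume (Icc (0 : ℝ) 1) := measure_mono fun y hy => hy.1
    _ = 1 := by simp

lemma volume_heightSet_zero : volume (heightSet 0) = 1 := by
  have : heightSet 0 = Icc (0 : ℝ) 1 := by ext y; simp [heightSet]
  simp [this]

lemma measurableSet_heightSet (b : ℝ) : MeasurableSet (heightSet b) :=
  measurableSet_Icc.inter (measurableSet_Icc.preimage (measurable_id.add_const (2 * b)))

lemma enorm_deltah_rpow {τ : ℝ} (hτ : 0 < τ) (ε : ℝ) (h x : Plane) :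
    domEx.indicator (fun x => ‖deltah domEx 2 h (splineDisc ε) x‖ₑ ^ τ) x =
      (centreSet (h 0)).indicator (rampDiff τ ε (h 0)) (x 0 + h 0) *
        (heightSet (h 1)).indicator 1 (x 1) := by
  by_cases hx : x ∈ domEx
  swap
  · rw [indicator_of_notMem hx]
    by_cases hx1 : x 1 ∈ heightSet (h 1)
    · rw [indicator_of_notMem, zero_mul]
      intro hc
      apply hx
      refine ⟨?_, hx1.1⟩
      simpa using hc.1
    · rw [indicator_of_notMem hx1, mul_zero]
  rw [indicator_of_mem hx]
  by_cases hy : x + (2 : ℝ) • h ∈ domEx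
  · have hy0 : x 0 + 2 * h 0 ∈ Icc (-1 : ℝ) 1 := by simpa using hy.1
    have hy1 : x 1 + 2 * h 1 ∈ Icc (0 : ℝ) 1 := by simpa using hy.2
    have hc : x 0 + h 0 ∈ centreSet (h 0) := by
      refine ⟨by simpa using hx.1, ?_⟩
      rwa [add_assoc, ← two_mul]
    have hm : x + h ∈ domEx := by
      have := convex_domEx hx hy (a := 1 / 2) (b := 1 / 2) (by norm_num) (by norm_num) (by norm_num)
      convert this using 1
      module
    rw [indicator_of_mem hc, indicator_of_mem (show x 1 ∈ heightSet (h 1) from ⟨hx.2, hy1⟩)]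
    have hs : segment ℝ x (x + ((2 : ℕ) : ℝ) • h) ⊆ domEx :=
      segment_subset_domEx_iff.2 ⟨hx, by exact_mod_cast hy⟩
    unfold deltah rampDiff
    rw [if_pos hs]
    simp only [Finset.sum_range_succ, Finset.sum_range_zero, Nat.cast_zero, zero_smul, add_zero,
      Nat.cast_one, one_smul, Nat.cast_ofNat, Pi.one_apply, mul_one]
    rw [splineDisc_eq_ramp ε hx, splineDisc_eq_ramp ε hm, splineDisc_eq_ramp ε hy]
    congr 2
    have e1 : x 0 + h 0 + h 0 = x 0 + 2 * h 0 := by ring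
    rw [e1, add_sub_cancel_right]
    simp
    ring
  · have hs : ¬ segment ℝ x (x + ((2 : ℕ) : ℝ) • h) ⊆ domEx := fun hs =>
      hy (by exact_mod_cast (segment_subset_domEx_iff.1 hs).2)
    unfold deltah
    rw [if_neg hs, enorm_zero, ENNReal.zero_rpow_of_pos hτ]
    by_cases hc : x 0 + h 0 ∈ centreSet (h 0)
    · rw [indicator_of_notMem (s := heightSet (h 1)), mul_zero]
      intro hh
      apply hy
      refine ⟨?_, by simpa using hh.2⟩
      have := hc.2
      rw [add_assoc, ← two_mul] at this
      simpa using this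
    · rw [indicator_of_notMem hc, zero_mul]

lemma lpNormE_deltah {τ : ℝ} (hτ : 0 < τ) (ε : ℝ) (h : Plane) :
    lpNormE τ domEx (deltah domEx 2 h (splineDisc ε)) ^ τ =
      rampMass τ ε (h 0) * volume (heightSet (h 1)) := by
  have hm : Measurable ((centreSet (h 0)).indicator (rampDiff τ ε (h 0))) :=
    (measurable_rampDiff τ ε (h 0)).indicator (measurableSet_centreSet _)
  rw [lpNormE_rpow hτ, ← lintegral_indicator measurableSet_domEx]
  simp_rw [enorm_deltah_rpow hτ]
  rw [lintegral_plane_mul (U := fun u => (centreSet (h 0)).indicator (rampDiff τ ε (h 0)) (u + h 0))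
    (hm.comp (measurable_id.add_const _))
    (measurable_one.indicator (measurableSet_heightSet _)),
    lintegral_add_right_eq_self, lintegral_indicator (measurableSet_centreSet _),
    lintegral_indicator_one (measurableSet_heightSet _), rampMass]

lemma rampMass_abs (τ ε a : ℝ) : rampMass τ ε |a| = rampMass τ ε a := by
  rcases abs_choice a with h | h
  · rw [h]
  · rw [h]
    have e : centreSet (-a) = centreSet a := by
      ext v; simp only [centreSet, sub_neg_eq_add, ← sub_eq_add_neg]; exact and_comm
    unfold rampMass
    rw [e]
    congr 1; ext v
    unfold rampDiff
    congr 2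
    rw [sub_neg_eq_add, ← sub_eq_add_neg]; ring

lemma ramp_of_le {ε u : ℝ} (h : ε ≤ u) : ramp ε u = u := if_pos h

lemma ramp_of_lt {ε u : ℝ} (h : u < ε) : ramp ε u = 0 := if_neg h.not_ge

lemma rampDiff_of_left {τ ε a v : ℝ} (h0 : 0 ≤ ε) (ha : 0 ≤ a) (h : ε ≤ v + a) (hv : v < ε) :
    rampDiff τ ε a v = ENNReal.ofReal (v + a) ^ τ := by
  unfold rampDiff
  rw [ramp_of_le h, ramp_of_lt hv, ramp_of_lt ((sub_le_self v ha).trans_lt hv),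
    Real.enorm_eq_ofReal_abs, abs_of_nonneg (by linarith)]
  congr 2; ring

lemma rampDiff_of_right {τ ε a v : ℝ} (ha : 0 ≤ a) (h : ε ≤ v) (hv : v - a < ε) :
    rampDiff τ ε a v = ENNReal.ofReal |a - v| ^ τ := by
  unfold rampDiff
  rw [ramp_of_le (le_add_of_le_of_nonneg h ha), ramp_of_le h, ramp_of_lt hv,
    Real.enorm_eq_ofReal_abs]
  congr 3; ring

lemma rampDiff_of_far_left {τ ε a v : ℝ} (hτ : 0 < τ) (ha : 0 ≤ a) (h : v + a < ε) :
    rampDiff τ ε a v = 0 := by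
  unfold rampDiff
  rw [ramp_of_lt h, ramp_of_lt (by linarith), ramp_of_lt (by linarith)]
  simp [hτ]

lemma rampDiff_of_far_right {τ ε a v : ℝ} (hτ : 0 < τ) (ha : 0 ≤ a) (h : ε ≤ v - a) :
    rampDiff τ ε a v = 0 := by
  unfold rampDiff
  rw [ramp_of_le (show ε ≤ v + a by linarith [h, ha]), ramp_of_le (show ε ≤ v by linarith [h, ha]),
    ramp_of_le h]
  have : v + a - 2 * v + (v - a) = 0 := by ring
  simp [hτ, this]

/-- The function `y ↦ y ^ τ` on `[0, δ)`, extended by zero. -/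
def cutPow (τ δ : ℝ) : ℝ → ℝ≥0∞ := (Ico 0 δ).indicator fun y => ENNReal.ofReal y ^ τ

lemma measurable_cutPow (τ δ : ℝ) : Measurable (cutPow τ δ) :=
  (ENNReal.measurable_ofReal.pow_const τ).indicator measurableSet_Ico

lemma cutPow_of_mem {τ δ y : ℝ} (h0 : 0 ≤ y) (h : y < δ) :
    cutPow τ δ y = ENNReal.ofReal y ^ τ := indicator_of_mem (show y ∈ Ico 0 δ from ⟨h0, h⟩) _

lemma cutPow_of_neg {τ δ y : ℝ} (h : y < 0) : cutPow τ δ y = 0 :=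
  indicator_of_notMem (fun hy => absurd hy.1 h.not_ge) _

lemma cutPow_of_le {τ δ y : ℝ} (h : δ ≤ y) : cutPow τ δ y = 0 :=
  indicator_of_notMem (fun hy => absurd hy.2 h.not_gt) _

lemma lintegral_cutPow_le {τ δ : ℝ} (hτ : 0 < τ) (hδ : 0 ≤ δ) :
    ∫⁻ y, cutPow τ δ y ≤ ENNReal.ofReal (δ ^ (τ + 1)) := by
  calc ∫⁻ y, cutPow τ δ y
      ≤ ∫⁻ y, (Ico 0 δ).indicator (fun _ => ENNReal.ofReal δ ^ τ) y := by
        refine lintegral_mono fun y => ?_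
        by_cases hy : y ∈ Ico 0 δ
        · rw [cutPow_of_mem hy.1 hy.2, indicator_of_mem hy]
          gcongr
          exact hy.2.le
        · rw [cutPow, indicator_of_notMem hy]; exact zero_le
    _ = ENNReal.ofReal (δ ^ (τ + 1)) := by
        rw [lintegral_indicator measurableSet_Ico, setLIntegral_const, Real.volume_Ico, sub_zero,
          ENNReal.ofReal_rpow_of_nonneg hδ hτ.le, ← ENNReal.ofReal_mul (by positivity),
          Real.rpow_add_one' hδ (by positivity)]

lemma rampDiff_zero_add_le {τ ε a : ℝ} (hτ : 0 < τ) (hε : 0 < ε) (ha : ε ≤ a) (v : ℝ) :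
    rampDiff τ 0 a v + cutPow τ ε (v - a) ≤ rampDiff τ ε a v + cutPow τ ε (v + a) := by
  have ha0 : 0 ≤ a := hε.le.trans ha
  rcases lt_or_ge v a with h | h
  · rw [cutPow_of_neg (show v - a < 0 by linarith), add_zero]
    rcases lt_or_ge (v + a) 0 with h1 | h1
    · rw [rampDiff_of_far_left hτ ha0 h1]; exact zero_le
    rcases lt_or_ge v 0 with h2 | h2
    · rw [rampDiff_of_left le_rfl ha0 h1 h2]
      rcases lt_or_ge (v + a) ε with h3 | h3
      · rw [cutPow_of_mem h1 h3]; exact le_add_self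
      · rw [rampDiff_of_left hε.le ha0 h3 (by linarith)]; exact le_self_add
    · rw [rampDiff_of_right ha0 h2 (by linarith)]
      refine le_trans ?_ le_self_add
      rcases lt_or_ge v ε with h3 | h3
      · rw [rampDiff_of_left hε.le ha0 (by linarith) h3, abs_of_nonneg (by linarith)]
        gcongr
        linarith
      · rw [rampDiff_of_right ha0 h3 (by linarith)]
  · rw [rampDiff_of_far_right hτ ha0 (by linarith), zero_add]
    rcases lt_or_ge (v - a) ε with h1 | h1
    · rw [cutPow_of_mem (by linarith) h1, rampDiff_of_right ha0 (by linarith) h1, abs_sub_comm,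
        abs_of_nonneg (by linarith)]
      exact le_self_add
    · rw [cutPow_of_le h1]; exact zero_le

lemma rampMass_zero_add_le {τ ε a : ℝ} (hτ : 0 < τ) (hε : 0 < ε) (ha : ε ≤ a) :
    rampMass τ 0 a + ∫⁻ v in centreSet a, cutPow τ ε (v - a) ≤
      rampMass τ ε a + ∫⁻ y, cutPow τ ε y := by
  calc rampMass τ 0 a + ∫⁻ v in centreSet a, cutPow τ ε (v - a)
      = ∫⁻ v in centreSet a, (rampDiff τ 0 a v + cutPow τ ε (v - a)) :=
        (lintegral_add_left (measurable_rampDiff τ 0 a) _).symm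
    _ ≤ ∫⁻ v in centreSet a, (rampDiff τ ε a v + cutPow τ ε (v + a)) :=
        lintegral_mono fun v => rampDiff_zero_add_le hτ hε ha v
    _ = rampMass τ ε a + ∫⁻ v in centreSet a, cutPow τ ε (v + a) :=
        lintegral_add_left (measurable_rampDiff τ ε a) _
    _ ≤ rampMass τ ε a + ∫⁻ v, cutPow τ ε (v + a) := by gcongr; exact Measure.restrict_le_self
    _ = rampMass τ ε a + ∫⁻ y, cutPow τ ε y := by rw [lintegral_add_right_eq_self]

lemma rampMass_zero_le_of_large {τ ε a : ℝ} (hτ : 0 < τ) (hε : 0 < ε) (ha : ε ≤ a)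
    (ha1 : 2 * a + ε ≤ 1) : rampMass τ 0 a ≤ rampMass τ ε a := by
  have h := rampMass_zero_add_le hτ hε ha
  have e : ∫⁻ v in centreSet a, cutPow τ ε (v - a) = ∫⁻ y, cutPow τ ε y := by
    rw [← lintegral_sub_right_eq_self (cutPow τ ε) a]
    refine setLIntegral_eq_of_support_subset fun v hv => ?_
    have hv' : v - a ∈ Ico 0 ε := by
      by_contra hc
      exact hv (indicator_of_notMem hc _)
    obtain ⟨h1, h2⟩ := hv'
    exact ⟨⟨by linarith, by linarith⟩, ⟨by linarith, by linarith⟩⟩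
  rw [e] at h
  exact (ENNReal.add_le_add_iff_right
    ((lintegral_cutPow_le hτ hε.le).trans_lt ENNReal.ofReal_lt_top).ne).1 h

lemma rampMass_zero_le_two_mul {τ a t : ℝ} (hτ : 0 < τ) (ha : 0 ≤ a) (hat : a ≤ t) :
    rampMass τ 0 a ≤ (∫⁻ y, cutPow τ t y) + ∫⁻ y, cutPow τ t y := by
  set g : ℝ → ℝ≥0∞ := (Ioc 0 t).indicator fun y => ENNReal.ofReal y ^ τ with hg
  have hgm : Measurable g := (ENNReal.measurable_ofReal.pow_const τ).indicator measurableSet_Ioc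
  have hgi : ∫⁻ y, g y = ∫⁻ y, cutPow τ t y := by
    unfold cutPow
    rw [hg, lintegral_indicator measurableSet_Ioc, lintegral_indicator measurableSet_Ico]
    exact setLIntegral_congr Ico_ae_eq_Ioc.symm
  have key : ∀ v, rampDiff τ 0 a v ≤ cutPow τ t (v + t) + g (t - v) := by
    intro v
    rcases lt_or_ge (v + a) 0 with h1 | h1
    · rw [rampDiff_of_far_left hτ ha h1]; exact zero_le
    rcases lt_or_ge v 0 with h2 | h2
    · rw [rampDiff_of_left le_rfl ha h1 h2, cutPow_of_mem (by linarith) (by linarith)]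
      refine le_trans ?_ le_self_add
      gcongr
    rcases lt_or_ge v a with h3 | h3
    · rw [rampDiff_of_right ha h2 (by linarith), hg,
        indicator_of_mem (show t - v ∈ Ioc 0 t from ⟨by linarith, by linarith⟩),
        abs_of_nonneg (by linarith)]
      refine le_trans ?_ le_add_self
      gcongr
    · rw [rampDiff_of_far_right hτ ha (by linarith)]; exact zero_le
  calc rampMass τ 0 a ≤ ∫⁻ v, rampDiff τ 0 a v := setLIntegral_le_lintegral _ _
    _ ≤ ∫⁻ v, (cutPow τ t (v + t) + g (t - v)) := lintegral_mono key
    _ = (∫⁻ v, cutPow τ t (v + t)) + ∫⁻ v, g (t - v) :=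
        lintegral_add_left ((measurable_cutPow τ t).comp (measurable_id.add_const t)) _
    _ = _ := by rw [lintegral_add_right_eq_self, lintegral_sub_left_eq_self, hgi]

lemma two_mul_add_le_rampMass {τ ε t : ℝ} {κ : ℝ≥0∞} (hε : 0 < ε) (ht : 0 ≤ t)
    (hτ : 0 < τ) (htε : t ≤ ε) (ht1 : 2 * t + ε ≤ 1)
    (hκ : ENNReal.ofReal t ^ τ + κ ≤ ENNReal.ofReal ε ^ τ) :
    (∫⁻ y, cutPow τ t y) + (∫⁻ y, cutPow τ t y) + κ * ENNReal.ofReal t ≤ rampMass τ ε t := by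
  have key : ∀ v, cutPow τ t (v - (ε - t)) + cutPow τ t (v - ε) +
      (Ico (ε - t) ε).indicator (fun _ => κ) v ≤
      (centreSet t).indicator (rampDiff τ ε t) v := by
    intro v
    rcases lt_or_ge v (ε - t) with h1 | h1
    · rw [cutPow_of_neg (by linarith), cutPow_of_neg (by linarith),
        indicator_of_notMem (fun h => absurd h.1 h1.not_ge)]
      simp
    rcases lt_or_ge v ε with h2 | h2
    · rw [cutPow_of_mem (by linarith) (by linarith), cutPow_of_neg (by linarith),
        indicator_of_mem (show v ∈ Ico (ε - t) ε from ⟨h1, h2⟩), indicator_of_mem,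
        rampDiff_of_left hε.le ht (by linarith) h2, add_zero]
      · calc ENNReal.ofReal (v - (ε - t)) ^ τ + κ ≤ ENNReal.ofReal t ^ τ + κ := by
              gcongr; linarith
          _ ≤ ENNReal.ofReal ε ^ τ := hκ
          _ ≤ ENNReal.ofReal (v + t) ^ τ := by gcongr; linarith
      · exact ⟨⟨by linarith, by linarith⟩, ⟨by linarith, by linarith⟩⟩
    rw [cutPow_of_le (show t ≤ v - (ε - t) by linarith),
      indicator_of_notMem (fun h => absurd h.2 h2.not_gt), add_zero, zero_add]
    rcases lt_or_ge (v - t) ε with h3 | h3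
    · rw [cutPow_of_mem (by linarith) (by linarith), indicator_of_mem,
        rampDiff_of_right ht h2 h3, abs_sub_comm, abs_of_nonneg (by linarith)]
      · gcongr
      · exact ⟨⟨by linarith, by linarith⟩, ⟨by linarith, by linarith⟩⟩
    · rw [cutPow_of_le (by linarith)]; exact zero_le
  have hm := measurable_cutPow τ t
  calc (∫⁻ y, cutPow τ t y) + (∫⁻ y, cutPow τ t y) + κ * ENNReal.ofReal t
      = ∫⁻ v, (cutPow τ t (v - (ε - t)) + cutPow τ t (v - ε) +
          (Ico (ε - t) ε).indicator (fun _ => κ) v) := by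
        rw [lintegral_add_right _ (measurable_const.indicator measurableSet_Ico),
          lintegral_add_left (f := fun v => cutPow τ t (v - (ε - t)))
            (hm.comp (measurable_id.sub_const (ε - t))),
          lintegral_sub_right_eq_self, lintegral_sub_right_eq_self,
          lintegral_indicator measurableSet_Ico, setLIntegral_const, Real.volume_Ico,
          sub_sub_self]
    _ ≤ ∫⁻ v, (centreSet t).indicator (rampDiff τ ε t) v := lintegral_mono key
    _ = rampMass τ ε t := lintegral_indicator (measurableSet_centreSet t) _

lemma rampMass_zero_le {τ ε a : ℝ} (hτ : 0 < τ) (hε : 0 < ε) (ha : 0 ≤ a)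
    (ha1 : 2 * a + ε ≤ 1) : rampMass τ 0 a ≤ rampMass τ ε a := by
  rcases le_total ε a with h | h
  · exact rampMass_zero_le_of_large hτ hε h ha1
  · have h2 := two_mul_add_le_rampMass (κ := 0) hε ha hτ h ha1 (by rw [add_zero]; gcongr)
    rw [zero_mul, add_zero] at h2
    exact (rampMass_zero_le_two_mul hτ ha le_rfl).trans h2

lemma rampMass_zero_le_add {τ ε a : ℝ} (hτ : 0 < τ) (hε : 0 < ε) (hε1 : ε ≤ 1 / 4) (ha : 0 ≤ a) :
    rampMass τ 0 a ≤ rampMass τ ε a + ENNReal.ofReal (ε ^ (τ + 1)) := by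
  rcases le_total ε a with h | h
  · exact (le_self_add.trans (rampMass_zero_add_le hτ hε h)).trans
      (by gcongr; exact lintegral_cutPow_le hτ hε.le)
  · exact (rampMass_zero_le hτ hε ha (by linarith)).trans le_self_add

lemma abs_apply_le_norm (h : Plane) (i : Fin 2) : |h i| ≤ ‖h‖ := by
  simpa using PiLp.norm_apply_le h i

lemma modulus_rpow_le {τ t : ℝ} (hτ : 0 < τ) (ε : ℝ) {X : ℝ≥0∞}
    (H : ∀ h : Plane, ‖h‖ ≤ t → rampMass τ ε |h 0| * volume (heightSet (h 1)) ≤ X) :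
    modulus domEx 2 τ (splineDisc ε) t ^ τ ≤ X := by
  rw [← ENNReal.le_rpow_inv_iff hτ]
  refine iSup₂_le fun h hh => ?_
  rw [ENNReal.le_rpow_inv_iff hτ, lpNormE_deltah hτ, ← rampMass_abs]
  exact H h hh

lemma le_modulus_rpow {τ t : ℝ} (hτ : 0 < τ) (ε : ℝ) {h : Plane} (hh : ‖h‖ ≤ t) :
    rampMass τ ε |h 0| * volume (heightSet (h 1)) ≤
      modulus domEx 2 τ (splineDisc ε) t ^ τ := by
  rw [rampMass_abs, ← lpNormE_deltah hτ]
  gcongr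
  exact le_iSup₂ (f := fun (h : Plane) (_ : ‖h‖ ≤ t) =>
    lpNormE τ domEx (deltah domEx 2 h (splineDisc ε))) h hh

lemma rampMass_le_modulus_rpow {τ t : ℝ} (hτ : 0 < τ) (ht : 0 ≤ t) (ε : ℝ) :
    rampMass τ ε t ≤ modulus domEx 2 τ (splineDisc ε) t ^ τ := by
  have h := le_modulus_rpow hτ ε (t := t) (h := EuclideanSpace.single 0 t)
    (by simp [abs_of_nonneg ht])
  simpa [volume_heightSet_zero, abs_of_nonneg ht] using h

lemma modulus_cont_le {τ ε t : ℝ} (hτ : 0 < τ) (hε : 0 < ε) (ht : 2 * t + ε ≤ 1) :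
    modulus domEx 2 τ (splineDisc 0) t ^ τ ≤ modulus domEx 2 τ (splineDisc ε) t ^ τ := by
  refine modulus_rpow_le hτ 0 fun h hh => le_trans ?_ (le_modulus_rpow hτ ε hh)
  have := (abs_apply_le_norm h 0).trans hh
  gcongr
  exact rampMass_zero_le hτ hε (abs_nonneg _) (by linarith)

lemma modulus_cont_le_add {τ ε : ℝ} (hτ : 0 < τ) (hε : 0 < ε) (hε1 : ε ≤ 1 / 4) (t : ℝ) :
    modulus domEx 2 τ (splineDisc 0) t ^ τ ≤
      modulus domEx 2 τ (splineDisc ε) t ^ τ + ENNReal.ofReal (ε ^ (τ + 1)) := by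
  refine modulus_rpow_le hτ 0 fun h hh => ?_
  calc rampMass τ 0 |h 0| * volume (heightSet (h 1))
      ≤ (rampMass τ ε |h 0| + ENNReal.ofReal (ε ^ (τ + 1))) * volume (heightSet (h 1)) := by
        gcongr; exact rampMass_zero_le_add hτ hε hε1 (abs_nonneg _)
    _ = rampMass τ ε |h 0| * volume (heightSet (h 1)) +
          ENNReal.ofReal (ε ^ (τ + 1)) * volume (heightSet (h 1)) := add_mul _ _ _
    _ ≤ _ := add_le_add (le_modulus_rpow hτ ε hh)
        (mul_le_of_le_one_right zero_le (volume_heightSet_le _))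

lemma modulus_cont_add_le {τ ε t : ℝ} {κ : ℝ≥0∞} (hτ : 0 < τ) (hε : 0 < ε) (ht : 0 ≤ t)
    (htε : t ≤ ε) (ht1 : 2 * t + ε ≤ 1)
    (hκ : ENNReal.ofReal t ^ τ + κ ≤ ENNReal.ofReal ε ^ τ) :
    modulus domEx 2 τ (splineDisc 0) t ^ τ + κ * ENNReal.ofReal t ≤
      modulus domEx 2 τ (splineDisc ε) t ^ τ := by
  refine le_trans ?_ (rampMass_le_modulus_rpow hτ ht ε)
  refine le_trans ?_ (two_mul_add_le_rampMass hε ht hτ htε ht1 hκ)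
  gcongr
  refine modulus_rpow_le hτ 0 fun h hh => ?_
  exact (mul_le_of_le_one_right zero_le (volume_heightSet_le _)).trans
    (rampMass_zero_le_two_mul hτ (abs_nonneg _) ((abs_apply_le_norm h 0).trans hh))

lemma besovSeminorm_rpow {s τ : ℝ} (hτ : 0 < τ) (f : Plane → ℝ) :
    besovSeminorm domEx 2 s τ f ^ τ =
      ∫⁻ t in Ioi (0 : ℝ), ENNReal.ofReal (t ^ (-(s * τ) - 1)) * modulus domEx 2 τ f t ^ τ := by
  unfold besovSeminorm
  rw [← ENNReal.rpow_mul, one_div_mul_cancel hτ.ne', ENNReal.rpow_one]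
  refine setLIntegral_congr_fun measurableSet_Ioi fun t ht => ?_
  have ht : 0 < t := ht
  rw [ENNReal.mul_rpow_of_nonneg _ _ hτ.le, ENNReal.ofReal_rpow_of_nonneg (by positivity) hτ.le,
    ← Real.rpow_mul ht.le, Real.rpow_sub_one ht.ne', ENNReal.ofReal_div_of_pos ht, neg_mul,
    ENNReal.div_eq_inv_mul, ENNReal.div_eq_inv_mul, mul_assoc]

lemma integral_weight_tail {r : ℝ} (hr : 0 < r) :
    ∫⁻ t in Ioi (1 / 4 : ℝ), ENNReal.ofReal (t ^ (-r - 1)) =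
      ENNReal.ofReal ((1 / 4 : ℝ) ^ (-r) / r) := by
  have h1 : -r - 1 < -1 := by linarith
  rw [← ofReal_integral_eq_lintegral_ofReal
    (integrableOn_Ioi_rpow_of_lt h1 (by norm_num : (0 : ℝ) < 1 / 4)),
    integral_Ioi_rpow_of_lt h1 (by norm_num)]
  · congr 1
    rw [sub_add_cancel, neg_div_neg_eq]
  · filter_upwards [ae_restrict_mem measurableSet_Ioi] with t ht
    have : 0 < t := lt_trans (by norm_num) ht
    simp only [Pi.zero_apply]
    positivity

/-- The gain on `[ε/4, ε/2]` against the loss on `(1/4, ∞)`. -/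
lemma besov_add_gain_le_add_loss {s τ ε : ℝ} (hs : 0 < s) (hτ : 0 < τ) (hε : 0 < ε)
    (hε1 : ε ≤ 1 / 4) :
    besovSeminorm domEx 2 s τ (splineDisc 0) ^ τ +
        ENNReal.ofReal ((1 - 2 ^ (-τ)) / 16 * ε ^ (τ - s * τ + 1)) ≤
      besovSeminorm domEx 2 s τ (splineDisc ε) ^ τ +
        ENNReal.ofReal ((1 / 4 : ℝ) ^ (-(s * τ)) / (s * τ) * ε ^ (τ + 1)) := by
  set w : ℝ → ℝ≥0∞ := fun t => ENNReal.ofReal (t ^ (-(s * τ) - 1)) with hw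
  have hwm : Measurable w := (measurable_id.pow_const _).ennreal_ofReal
  set κ : ℝ := (1 - 2 ^ (-τ)) * ε ^ τ with hκ
  have h2 : (2 : ℝ) ^ (-τ) < 1 := Real.rpow_lt_one_of_one_lt_of_neg (by norm_num) (by linarith)
  have hκ0 : 0 ≤ κ := mul_nonneg (by linarith) (by positivity)
  have hhalf : (ε / 2) ^ τ + κ = ε ^ τ := by
    rw [hκ, Real.div_rpow hε.le (by norm_num), Real.rpow_neg (by norm_num)]
    ring
  set g : ℝ → ℝ≥0∞ := (Icc (ε / 4) (ε / 2)).indicator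
    fun t => w t * (ENNReal.ofReal κ * ENNReal.ofReal t) with hg
  set l : ℝ → ℝ≥0∞ := (Ioi (1 / 4 : ℝ)).indicator
    fun t => w t * ENNReal.ofReal (ε ^ (τ + 1)) with hl
  have hgm : Measurable g :=
    (hwm.mul (measurable_const.mul ENNReal.measurable_ofReal)).indicator measurableSet_Icc
  have hlm : Measurable l := (hwm.mul measurable_const).indicator measurableSet_Ioi
  have key : ∀ t ∈ Ioi (0 : ℝ), w t * modulus domEx 2 τ (splineDisc 0) t ^ τ + g t ≤
      w t * modulus domEx 2 τ (splineDisc ε) t ^ τ + l t := by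
    intro t ht
    have ht : 0 < t := ht
    by_cases hmem : t ∈ Icc (ε / 4) (ε / 2)
    · refine le_trans ?_ le_self_add
      rw [hg, indicator_of_mem hmem, ← mul_add]
      gcongr
      have h3 := hmem.2
      refine modulus_cont_add_le hτ hε ht.le (by linarith) (by linarith) ?_
      rw [ENNReal.ofReal_rpow_of_nonneg ht.le hτ.le, ENNReal.ofReal_rpow_of_nonneg hε.le hτ.le,
        ← ENNReal.ofReal_add (by positivity) hκ0, ← hhalf]
      gcongr
    · rw [hg, indicator_of_notMem hmem, add_zero]
      rcases le_or_gt t (1 / 4) with h3 | h3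
      · refine le_trans ?_ le_self_add
        gcongr w t * ?_
        exact modulus_cont_le hτ hε (by linarith)
      · rw [hl, indicator_of_mem (show t ∈ Ioi (1 / 4 : ℝ) from h3), ← mul_add]
        gcongr
        exact modulus_cont_le_add hτ hε hε1 t
  have hgain : ENNReal.ofReal ((1 - 2 ^ (-τ)) / 16 * ε ^ (τ - s * τ + 1)) ≤
      ∫⁻ t in Ioi (0 : ℝ), g t := by
    have hsub : (Icc (ε / 4) (ε / 2)) ∩ Ioi (0 : ℝ) = Icc (ε / 4) (ε / 2) :=
      inter_eq_left.2 fun t ht => lt_of_lt_of_le (by positivity) ht.1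
    rw [hg, lintegral_indicator measurableSet_Icc, Measure.restrict_restrict measurableSet_Icc,
      hsub]
    calc ENNReal.ofReal ((1 - 2 ^ (-τ)) / 16 * ε ^ (τ - s * τ + 1))
        = ENNReal.ofReal (ε ^ (-(s * τ) - 1)) *
            (ENNReal.ofReal κ * ENNReal.ofReal (ε / 4)) * ENNReal.ofReal (ε / 2 - ε / 4) := by
          rw [← ENNReal.ofReal_mul hκ0, ← ENNReal.ofReal_mul (by positivity),
            ← ENNReal.ofReal_mul (by positivity)]
          congr 1
          have e : τ - s * τ + 1 = (-(s * τ) - 1) + τ + 1 + 1 := by ring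
          rw [hκ, e, Real.rpow_add_one hε.ne', Real.rpow_add_one hε.ne', Real.rpow_add hε]
          ring
      _ = ∫⁻ _ in Icc (ε / 4) (ε / 2), ENNReal.ofReal (ε ^ (-(s * τ) - 1)) *
            (ENNReal.ofReal κ * ENNReal.ofReal (ε / 4)) := by
          rw [setLIntegral_const, Real.volume_Icc]
      _ ≤ _ := by
          refine setLIntegral_mono (hwm.mul (measurable_const.mul ENNReal.measurable_ofReal))
            fun t ht => ?_
          have ht0 : 0 < t := lt_of_lt_of_le (by positivity) ht.1
          have hr : ε ^ (-(s * τ) - 1) ≤ t ^ (-(s * τ) - 1) := by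
            refine Real.rpow_le_rpow_of_nonpos ht0 (by linarith [ht.2]) ?_
            have := mul_pos hs hτ
            linarith
          have := ht.1
          simp only [hw]
          gcongr
  have hloss : ∫⁻ t in Ioi (0 : ℝ), l t ≤
      ENNReal.ofReal ((1 / 4 : ℝ) ^ (-(s * τ)) / (s * τ) * ε ^ (τ + 1)) := by
    calc ∫⁻ t in Ioi (0 : ℝ), l t ≤ ∫⁻ t, l t := setLIntegral_le_lintegral _ _
      _ = ENNReal.ofReal ((1 / 4 : ℝ) ^ (-(s * τ)) / (s * τ) * ε ^ (τ + 1)) := by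
        rw [hl, lintegral_indicator measurableSet_Ioi, lintegral_mul_const _ hwm, hw,
          integral_weight_tail (mul_pos hs hτ), ← ENNReal.ofReal_mul (by positivity)]
  rw [besovSeminorm_rpow hτ, besovSeminorm_rpow hτ]
  calc _ ≤ (∫⁻ t in Ioi (0 : ℝ), w t * modulus domEx 2 τ (splineDisc 0) t ^ τ) +
        ∫⁻ t in Ioi (0 : ℝ), g t := by gcongr
    _ = ∫⁻ t in Ioi (0 : ℝ), (w t * modulus domEx 2 τ (splineDisc 0) t ^ τ + g t) :=
        (lintegral_add_right _ hgm).symm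
    _ ≤ ∫⁻ t in Ioi (0 : ℝ), (w t * modulus domEx 2 τ (splineDisc ε) t ^ τ + l t) :=
        setLIntegral_mono' measurableSet_Ioi key
    _ = (∫⁻ t in Ioi (0 : ℝ), w t * modulus domEx 2 τ (splineDisc ε) t ^ τ) +
        ∫⁻ t in Ioi (0 : ℝ), l t := lintegral_add_right _ hlm
    _ ≤ _ := by gcongr

lemma lpNormE_disc_sub_cont_le {p ε : ℝ} (hp : 0 < p) (hε : 0 < ε) :
    lpNormE p domEx (fun x => splineDisc ε x - splineDisc 0 x) ≤
      ENNReal.ofReal (ε ^ (1 + 1 / p)) := by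
  have hpow : lpNormE p domEx (fun x => splineDisc ε x - splineDisc 0 x) ^ p ≤
      ENNReal.ofReal (ε ^ (1 + 1 / p)) ^ p := by
    rw [lpNormE_rpow hp, ← lintegral_indicator measurableSet_domEx]
    calc ∫⁻ x, domEx.indicator (fun x => ‖splineDisc ε x - splineDisc 0 x‖ₑ ^ p) x
        ≤ ∫⁻ x : Plane, (Ico 0 ε).indicator (fun _ => ENNReal.ofReal ε ^ p) (x 0) *
            (Icc (0 : ℝ) 1).indicator 1 (x 1) := by
          refine lintegral_mono fun x => ?_
          by_cases hx : x ∈ domEx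
          swap
          · rw [indicator_of_notMem hx]; exact zero_le
          rw [indicator_of_mem hx, splineDisc_eq_ramp ε hx, splineDisc_eq_ramp 0 hx,
            indicator_of_mem hx.2, Pi.one_apply, mul_one]
          rcases lt_or_ge (x 0) 0 with h1 | h1
          · rw [ramp_of_lt h1, ramp_of_lt (h1.trans hε)]; simp [hp]
          rcases lt_or_ge (x 0) ε with h2 | h2
          · rw [ramp_of_lt h2, ramp_of_le h1, indicator_of_mem (show x 0 ∈ Ico 0 ε from ⟨h1, h2⟩),
              zero_sub, enorm_neg, Real.enorm_eq_ofReal_abs, abs_of_nonneg h1]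
            gcongr
          · rw [ramp_of_le h1, ramp_of_le h2]; simp [hp]
      _ = ENNReal.ofReal (ε ^ (1 + 1 / p)) ^ p := by
          rw [lintegral_plane_mul (measurable_const.indicator measurableSet_Ico)
            (measurable_one.indicator measurableSet_Icc), lintegral_indicator measurableSet_Ico,
            setLIntegral_const, lintegral_indicator_one measurableSet_Icc, Real.volume_Ico,
            Real.volume_Icc, ENNReal.ofReal_rpow_of_nonneg hε.le hp.le,
            ENNReal.ofReal_rpow_of_nonneg (by positivity) hp.le, ← Real.rpow_mul hε.le]
          simp only [sub_zero, ENNReal.ofReal_one, mul_one]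
          rw [← ENNReal.ofReal_mul (by positivity), add_mul, one_div_mul_cancel hp.ne', one_mul,
            Real.rpow_add_one hε.ne']
  exact (ENNReal.rpow_le_rpow_iff hp).1 hpow

/-- **Maximum smoothness is essential: the Bernstein-type estimate fails for discontinuous
piecewise linear functions.** -/
theorem max_smoothness_necessary (p s τ : ℝ) (hp : 0 < p) (hs : 0 < s) (hs2 : s < 2 / p)
    (hτ : 1 / τ = s / 2 + 1 / p) (hτ1 : τ ≤ 1) :
    ∃ c ε₀ : ℝ, 0 < c ∧ 0 < ε₀ ∧
      ∀ ε : ℝ, 0 < ε → ε < ε₀ → ε < 1 / 4 →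
        (besovSeminorm domEx 2 s τ splineCont ^ τ +
            ENNReal.ofReal (c * ε ^ (τ - s * τ + 1)) ≤
          besovSeminorm domEx 2 s τ (splineDisc ε) ^ τ) ∧
        lpNormE p domEx (fun x => splineDisc ε x - splineCont x) ≤
          ENNReal.ofReal (ε ^ (1 + 1 / p)) ∧
        besovSeminorm domEx 2 s τ splineCont ^ τ +
            ENNReal.ofReal (c * ε ^ (-(s * τ / 2))) *
              lpNormE p domEx (fun x => splineDisc ε x - splineCont x) ^ τ ≤
          besovSeminorm domEx 2 s τ (splineDisc ε) ^ τ := by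
  have hτ0 : 0 < τ := by
    have : 0 < 1 / τ := by rw [hτ]; positivity
    exact one_div_pos.1 this
  have hr : 0 < s * τ := mul_pos hs hτ0
  have h2 : (2 : ℝ) ^ (-τ) < 1 := Real.rpow_lt_one_of_one_lt_of_neg (by norm_num) (by linarith)
  set c : ℝ := (1 - 2 ^ (-τ)) / 32 with hc
  have hc0 : 0 < c := by rw [hc]; linarith
  set C : ℝ := (1 / 4 : ℝ) ^ (-(s * τ)) / (s * τ) with hC
  have hC0 : 0 < C := by positivity
  have hexp : τ / p = 1 - s * τ / 2 := by
    have : τ * (1 / τ) = 1 := mul_one_div_cancel hτ0.ne'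
    rw [hτ] at this
    rw [div_eq_mul_one_div]
    linarith
  refine ⟨c, (c / C) ^ (1 / (s * τ)), hc0, by positivity, fun ε hε hε0 hε1 => ?_⟩
  have hsmall : C * ε ^ (τ + 1) ≤ c * ε ^ (τ - s * τ + 1) := by
    have h3 : ε ^ (s * τ) ≤ c / C := by
      calc ε ^ (s * τ) ≤ ((c / C) ^ (1 / (s * τ))) ^ (s * τ) := by gcongr
        _ = c / C := by
          rw [← Real.rpow_mul (by positivity), one_div_mul_cancel hr.ne', Real.rpow_one]
    have e : τ + 1 = s * τ + (τ - s * τ + 1) := by ring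
    rw [e, Real.rpow_add hε, ← mul_assoc]
    gcongr
    rw [mul_comm]
    exact (le_div_iff₀ hC0).1 h3
  have main : besovSeminorm domEx 2 s τ splineCont ^ τ +
      ENNReal.ofReal (c * ε ^ (τ - s * τ + 1)) ≤
        besovSeminorm domEx 2 s τ (splineDisc ε) ^ τ := by
    have h := besov_add_gain_le_add_loss hs hτ0 hε hε1.le
    have e : (1 - 2 ^ (-τ)) / 16 * ε ^ (τ - s * τ + 1) =
        c * ε ^ (τ - s * τ + 1) + c * ε ^ (τ - s * τ + 1) := by rw [hc]; ring
    rw [e, ENNReal.ofReal_add (by positivity) (by positivity), ← add_assoc] at h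
    exact (ENNReal.add_le_add_iff_right ENNReal.ofReal_ne_top).1
      (h.trans (by gcongr))
  have hdiff : lpNormE p domEx (fun x => splineDisc ε x - splineCont x) ≤
      ENNReal.ofReal (ε ^ (1 + 1 / p)) := lpNormE_disc_sub_cont_le hp hε
  refine ⟨main, hdiff, le_trans ?_ main⟩
  gcongr
  calc ENNReal.ofReal (c * ε ^ (-(s * τ / 2))) *
        lpNormE p domEx (fun x => splineDisc ε x - splineCont x) ^ τ
      ≤ ENNReal.ofReal (c * ε ^ (-(s * τ / 2))) * ENNReal.ofReal (ε ^ (1 + 1 / p)) ^ τ := by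
        gcongr
    _ = ENNReal.ofReal (c * ε ^ (τ - s * τ + 1)) := by
        rw [ENNReal.ofReal_rpow_of_nonneg (by positivity) hτ0.le,
          ← ENNReal.ofReal_mul (by positivity), ← Real.rpow_mul hε.le, mul_assoc,
          ← Real.rpow_add hε]
        congr 3
        have : (1 + 1 / p) * τ = τ + τ / p := by ring
        rw [this, hexp]
        ring

end
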